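/- In the normalized local setup at the origin, define the matrix K^{ab̄} = h^{-1} u_a conj(u_b) − h^{-1} g^{pq̄}(∂_p u_a − u_a h^{-1}∂_p h)·conj(∂_q u_b − u_b h^{-1}∂_q h) (u_0 = 1, u_i = z^i). Then for all 1 ≤ i,j,k,l ≤ n: (∂_k ∂_l̄ K^{ij̄})(0) = −R_{jīkl̄}(0) − (δ^{ij} δ_{kl} + δ^i_k δ^j_l), where R_{ij̄kl̄} = −∂_k∂_l̄ g_{ij̄} + g^{pq̄}(∂_l̄ g_{pj̄})(∂_k g_{iq̄}). -/

import Mathlib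

noncomputable section
open Complex Matrix
open scoped ComplexOrder

/-- The Wirtinger derivative `∂ₖ f = (1/2)(∂f/∂xᵏ − i ∂f/∂yᵏ)` of a complex-valued
function on `ℂⁿ` (with its Euclidean structure), where `zᵏ = xᵏ + i yᵏ`. -/
def wd {n : ℕ} (k : Fin n) (f : EuclideanSpace ℂ (Fin n) → ℂ)
    (z : EuclideanSpace ℂ (Fin n)) : ℂ :=
  (1/2 : ℂ) * (fderiv ℝ f z (EuclideanSpace.single k 1)
    - Complex.I * fderiv ℝ f z (EuclideanSpace.single k Complex.I))

/-- The conjugate Wirtinger derivative `∂ₖ̄ f = (1/2)(∂f/∂xᵏ + i ∂f/∂yᵏ)`. -/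
def wdb {n : ℕ} (k : Fin n) (f : EuclideanSpace ℂ (Fin n) → ℂ)
    (z : EuclideanSpace ℂ (Fin n)) : ℂ :=
  (1/2 : ℂ) * (fderiv ℝ f z (EuclideanSpace.single k 1)
    + Complex.I * fderiv ℝ f z (EuclideanSpace.single k Complex.I))

/-- The inverse transpose matrix `(g^{ij̄})` of a matrix-valued function `(g_{ij̄})`. -/
def ginv {n : ℕ} (g : Fin n → Fin n → EuclideanSpace ℂ (Fin n) → ℂ)
    (z : EuclideanSpace ℂ (Fin n)) : Matrix (Fin n) (Fin n) ℂ :=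
  ((Matrix.of fun i j => g i j z)⁻¹)ᵀ

/-- The Riemann curvature tensor
`R_{ij̄kl̄} = −∂_k∂_l̄ g_{ij̄} + g^{pq̄}(∂_l̄ g_{pj̄})(∂_k g_{iq̄})`. -/
def Riem {n : ℕ} (g : Fin n → Fin n → EuclideanSpace ℂ (Fin n) → ℂ)
    (i j k l : Fin n) (z : EuclideanSpace ℂ (Fin n)) : ℂ :=
  - wd k (wdb l (g i j)) z
    + ∑ p, ∑ q, ginv g z p q * wdb l (g p j) z * wd k (g i q) z

/-- The functions `u_0 = 1`, `u_i = z^i` (`1 ≤ i ≤ n`), indexed by `Fin (n+1)`. -/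
def uu {n : ℕ} (a : Fin (n + 1)) (z : EuclideanSpace ℂ (Fin n)) : ℂ :=
  if h : a = 0 then 1 else z (a.pred h)

/-- The matrix `H^{ab̄} = h u_a conj(u_b)
  + h g^{pq̄}(∂_p u_a + u_a h⁻¹ ∂_p h) conj(∂_q u_b + u_b h⁻¹ ∂_q h)`. -/
def Hmat {n : ℕ} (h : EuclideanSpace ℂ (Fin n) → ℝ)
    (g : Fin n → Fin n → EuclideanSpace ℂ (Fin n) → ℂ)
    (a b : Fin (n + 1)) (z : EuclideanSpace ℂ (Fin n)) : ℂ :=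
  (h z : ℂ) * uu a z * (starRingEnd ℂ) (uu b z)
    + (h z : ℂ) * ∑ p, ∑ q, ginv g z p q
        * (wd p (uu a) z + uu a z * (h z : ℂ)⁻¹ * wd p (fun w => (h w : ℂ)) z)
        * (starRingEnd ℂ)
            (wd q (uu b) z + uu b z * (h z : ℂ)⁻¹ * wd q (fun w => (h w : ℂ)) z)

/-- The matrix `K^{ab̄} = h⁻¹ u_a conj(u_b)
  − h⁻¹ g^{pq̄}(∂_p u_a − u_a h⁻¹ ∂_p h) conj(∂_q u_b − u_b h⁻¹ ∂_q h)`. -/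
def Kmat {n : ℕ} (h : EuclideanSpace ℂ (Fin n) → ℝ)
    (g : Fin n → Fin n → EuclideanSpace ℂ (Fin n) → ℂ)
    (a b : Fin (n + 1)) (z : EuclideanSpace ℂ (Fin n)) : ℂ :=
  (h z : ℂ)⁻¹ * uu a z * (starRingEnd ℂ) (uu b z)
    - (h z : ℂ)⁻¹ * ∑ p, ∑ q, ginv g z p q
        * (wd p (uu a) z - uu a z * (h z : ℂ)⁻¹ * wd p (fun w => (h w : ℂ)) z)
        * (starRingEnd ℂ)
            (wd q (uu b) z - uu b z * (h z : ℂ)⁻¹ * wd q (fun w => (h w : ℂ)) z)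


section helpers

variable {n : ℕ}

/-- smooth germ at the origin -/
def Sm (f : EuclideanSpace ℂ (Fin n) → ℂ) : Prop := ContDiffAt ℝ (⊤ : ℕ∞) f 0

lemma Sm.ev {f : EuclideanSpace ℂ (Fin n) → ℂ} (hf : Sm f) :
    ∀ᶠ z in nhds (0 : EuclideanSpace ℂ (Fin n)), DifferentiableAt ℝ f z := by
  have h1 : ContDiffAt ℝ 1 f 0 := ContDiffAt.of_le hf (by exact_mod_cast le_top)
  filter_upwards [h1.eventually (by simp)] with z hz
  exact hz.differentiableAt (by simp)

lemma Sm.fd {f : EuclideanSpace ℂ (Fin n) → ℂ} (hf : Sm f) (v : EuclideanSpace ℂ (Fin n)) :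
    Sm (fun z => fderiv ℝ f z v) := by
  have h1 : ContDiffAt ℝ (⊤ : ℕ∞) (fderiv ℝ f) 0 := ContDiffAt.fderiv_right (m := (⊤ : ℕ∞)) hf (by simp)
  exact h1.clm_apply contDiffAt_const

lemma Sm.wd {f : EuclideanSpace ℂ (Fin n) → ℂ} (hf : Sm f) (k : Fin n) : Sm (wd k f) :=
  contDiffAt_const.mul ((hf.fd _).sub (contDiffAt_const.mul (hf.fd _)))

lemma Sm.wdb {f : EuclideanSpace ℂ (Fin n) → ℂ} (hf : Sm f) (k : Fin n) : Sm (wdb k f) :=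
  contDiffAt_const.mul ((hf.fd _).add (contDiffAt_const.mul (hf.fd _)))

lemma wd_congr {f g : EuclideanSpace ℂ (Fin n) → ℂ} {z : EuclideanSpace ℂ (Fin n)}
    (e : f =ᶠ[nhds z] g) (k : Fin n) : wd k f z = wd k g z := by
  simp only [wd, e.fderiv_eq]

lemma wdb_congr {f g : EuclideanSpace ℂ (Fin n) → ℂ} {z : EuclideanSpace ℂ (Fin n)}
    (e : f =ᶠ[nhds z] g) (k : Fin n) : wdb k f z = wdb k g z := by
  simp only [wdb, e.fderiv_eq]

lemma wd_mul {f g : EuclideanSpace ℂ (Fin n) → ℂ} {z : EuclideanSpace ℂ (Fin n)}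
    (hf : DifferentiableAt ℝ f z) (hg : DifferentiableAt ℝ g z) (k : Fin n) :
    wd k (fun w => f w * g w) z = f z * wd k g z + wd k f z * g z := by
  simp only [wd, fderiv_fun_mul hf hg]
  simp
  ring

lemma wdb_mul {f g : EuclideanSpace ℂ (Fin n) → ℂ} {z : EuclideanSpace ℂ (Fin n)}
    (hf : DifferentiableAt ℝ f z) (hg : DifferentiableAt ℝ g z) (k : Fin n) :
    wdb k (fun w => f w * g w) z = f z * wdb k g z + wdb k f z * g z := by
  simp only [wdb, fderiv_fun_mul hf hg]
  simp
  ring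

lemma wd_add {f g : EuclideanSpace ℂ (Fin n) → ℂ} {z : EuclideanSpace ℂ (Fin n)}
    (hf : DifferentiableAt ℝ f z) (hg : DifferentiableAt ℝ g z) (k : Fin n) :
    wd k (fun w => f w + g w) z = wd k f z + wd k g z := by
  simp only [wd, fderiv_fun_add hf hg]
  simp
  ring

lemma wdb_add {f g : EuclideanSpace ℂ (Fin n) → ℂ} {z : EuclideanSpace ℂ (Fin n)}
    (hf : DifferentiableAt ℝ f z) (hg : DifferentiableAt ℝ g z) (k : Fin n) :
    wdb k (fun w => f w + g w) z = wdb k f z + wdb k g z := by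
  simp only [wdb, fderiv_fun_add hf hg]
  simp
  ring

lemma wd_const (c : ℂ) (z : EuclideanSpace ℂ (Fin n)) (k : Fin n) :
    wd k (fun _ => c) z = 0 := by
  simp [wd]

lemma wdb_const (c : ℂ) (z : EuclideanSpace ℂ (Fin n)) (k : Fin n) :
    wdb k (fun _ => c) z = 0 := by
  simp [wdb]

lemma wd_conj (f : EuclideanSpace ℂ (Fin n) → ℂ) (z : EuclideanSpace ℂ (Fin n)) (k : Fin n) :
    wd k (fun w => (starRingEnd ℂ) (f w)) z = (starRingEnd ℂ) (wdb k f z) := by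
  have : fderiv ℝ (fun w => (starRingEnd ℂ) (f w)) z
      = (Complex.conjCLE : ℂ →L[ℝ] ℂ).comp (fderiv ℝ f z) :=
    Complex.conjCLE.comp_fderiv (f := f) (x := z)
  have h2 : (starRingEnd ℂ) 2 = 2 := Complex.conj_ofNat 2
  simp [wd, wdb, this, h2]
  ring

lemma wdb_conj (f : EuclideanSpace ℂ (Fin n) → ℂ) (z : EuclideanSpace ℂ (Fin n)) (k : Fin n) :
    wdb k (fun w => (starRingEnd ℂ) (f w)) z = (starRingEnd ℂ) (wd k f z) := by
  have : fderiv ℝ (fun w => (starRingEnd ℂ) (f w)) z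
      = (Complex.conjCLE : ℂ →L[ℝ] ℂ).comp (fderiv ℝ f z) :=
    Complex.conjCLE.comp_fderiv (f := f) (x := z)
  have h2 : (starRingEnd ℂ) 2 = 2 := Complex.conj_ofNat 2
  simp [wd, wdb, this, h2]

lemma uu_succ (i : Fin n) :
    uu i.succ = fun z : EuclideanSpace ℂ (Fin n) => z i := by
  funext z
  simp [uu]

lemma fderiv_coord (i : Fin n) (z v : EuclideanSpace ℂ (Fin n)) :
    fderiv ℝ (fun z : EuclideanSpace ℂ (Fin n) => z i) z v = v i := by
  have := ((EuclideanSpace.proj i : EuclideanSpace ℂ (Fin n) →L[ℂ] ℂ).restrictScalars ℝ).fderiv (x := z)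
  have h2 := congrArg (fun L => L v) this
  exact h2

lemma sm_coord (i : Fin n) : Sm (fun z : EuclideanSpace ℂ (Fin n) => z i) :=
  ((EuclideanSpace.proj i : EuclideanSpace ℂ (Fin n) →L[ℂ] ℂ).restrictScalars ℝ).contDiff.contDiffAt

lemma wd_coord (i k : Fin n) (z : EuclideanSpace ℂ (Fin n)) :
    wd k (fun z : EuclideanSpace ℂ (Fin n) => z i) z = if i = k then 1 else 0 := by
  simp only [wd, fderiv_coord]
  by_cases hik : i = k
  · subst hik; simp; norm_num
  · simp [hik]

lemma wdb_coord (i k : Fin n) (z : EuclideanSpace ℂ (Fin n)) :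
    wdb k (fun z : EuclideanSpace ℂ (Fin n) => z i) z = 0 := by
  simp only [wdb, fderiv_coord]
  by_cases hik : i = k
  · subst hik; simp
  · simp [hik]

/-- The mixed second order jet at the origin. -/
structure Jet (k l : Fin n) (f : EuclideanSpace ℂ (Fin n) → ℂ) (a b c d : ℂ) : Prop where
  sm : Sm f
  v : f 0 = a
  d1 : wd k f 0 = b
  d2 : wdb l f 0 = c
  dd : wd k (wdb l f) 0 = d

variable {k l : Fin n}

lemma Sm.jet {f : EuclideanSpace ℂ (Fin n) → ℂ} (hf : Sm f) :
    Jet k l f (f 0) (_root_.wd k f 0) (_root_.wdb l f 0)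
      (_root_.wd k (_root_.wdb l f) 0) := ⟨hf, rfl, rfl, rfl, rfl⟩

lemma Sm.da {f : EuclideanSpace ℂ (Fin n) → ℂ} (hf : Sm f) : DifferentiableAt ℝ f 0 :=
  hf.ev.self_of_nhds

lemma Jet.congr {f g : EuclideanSpace ℂ (Fin n) → ℂ} {a b c d : ℂ} (hf : Jet k l f a b c d)
    (e : g =ᶠ[nhds 0] f) : Jet k l g a b c d := by
  refine ⟨ContDiffAt.congr_of_eventuallyEq hf.sm e, e.self_of_nhds.trans hf.v,
    (wd_congr e k).trans hf.d1, (wdb_congr e l).trans hf.d2, ?_⟩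
  rw [← hf.dd]
  apply wd_congr
  filter_upwards [e.eventually_nhds] with z hz
  exact wdb_congr hz l

lemma Jet.const (c : ℂ) : Jet k l (fun _ : EuclideanSpace ℂ (Fin n) => c) c 0 0 0 := by
  refine ⟨contDiffAt_const, rfl, wd_const _ _ _, wdb_const _ _ _, ?_⟩
  have : wdb l (fun _ : EuclideanSpace ℂ (Fin n) => c) = fun _ => 0 := by
    funext z; exact wdb_const _ _ _
  rw [this, wd_const]

lemma Jet.mul {f g : EuclideanSpace ℂ (Fin n) → ℂ} {a b c d a' b' c' d' : ℂ}
    (hf : Jet k l f a b c d) (hg : Jet k l g a' b' c' d') :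
    Jet k l (fun w => f w * g w) (a * a') (a * b' + b * a') (a * c' + c * a')
      (a * d' + b * c' + c * b' + d * a') := by
  refine ⟨ContDiffAt.mul hf.sm hg.sm, by rw [hf.v, hg.v], ?_, ?_, ?_⟩
  · rw [wd_mul hf.sm.da hg.sm.da, hf.v, hg.v, hf.d1, hg.d1]
  · rw [wdb_mul hf.sm.da hg.sm.da, hf.v, hg.v, hf.d2, hg.d2]
  · have e : wdb l (fun w => f w * g w) =ᶠ[nhds 0] fun z => f z * wdb l g z + wdb l f z * g z := by
      filter_upwards [hf.sm.ev, hg.sm.ev] with z h1 h2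
      exact wdb_mul h1 h2 l
    rw [wd_congr e, wd_add, wd_mul hf.sm.da (hg.sm.wdb l).da, wd_mul (hf.sm.wdb l).da hg.sm.da,
      hf.v, hg.v, hf.d1, hg.d1, hf.d2, hg.d2, hf.dd, hg.dd]
    · ring
    · exact hf.sm.da.mul (hg.sm.wdb l).da
    · exact (hf.sm.wdb l).da.mul hg.sm.da

lemma Jet.add {f g : EuclideanSpace ℂ (Fin n) → ℂ} {a b c d a' b' c' d' : ℂ}
    (hf : Jet k l f a b c d) (hg : Jet k l g a' b' c' d') :
    Jet k l (fun w => f w + g w) (a + a') (b + b') (c + c') (d + d') := by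
  refine ⟨ContDiffAt.add hf.sm hg.sm, by rw [hf.v, hg.v], ?_, ?_, ?_⟩
  · rw [wd_add hf.sm.da hg.sm.da, hf.d1, hg.d1]
  · rw [wdb_add hf.sm.da hg.sm.da, hf.d2, hg.d2]
  · have e : wdb l (fun w => f w + g w) =ᶠ[nhds 0] fun z => wdb l f z + wdb l g z := by
      filter_upwards [hf.sm.ev, hg.sm.ev] with z h1 h2
      exact wdb_add h1 h2 l
    rw [wd_congr e, wd_add (hf.sm.wdb l).da (hg.sm.wdb l).da, hf.dd, hg.dd]

lemma Jet.cast {f : EuclideanSpace ℂ (Fin n) → ℂ} {a b c d a' b' c' d' : ℂ}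
    (hf : Jet k l f a b c d) (h1 : a = a') (h2 : b = b') (h3 : c = c') (h4 : d = d') :
    Jet k l f a' b' c' d' := by
  subst h1 h2 h3 h4; exact hf

lemma Jet.sub {f g : EuclideanSpace ℂ (Fin n) → ℂ} {a b c d a' b' c' d' : ℂ}
    (hf : Jet k l f a b c d) (hg : Jet k l g a' b' c' d') :
    Jet k l (fun w => f w - g w) (a - a') (b - b') (c - c') (d - d') := by
  refine ((hf.add ((Jet.const (-1)).mul hg)).congr (.of_eq ?_)).cast ?_ ?_ ?_ ?_
  · funext w; ring
  all_goals ring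

lemma Jet.sum {ι : Type*} (s : Finset ι) {f : ι → EuclideanSpace ℂ (Fin n) → ℂ}
    {a b c d : ι → ℂ} (hf : ∀ i, Jet k l (f i) (a i) (b i) (c i) (d i)) :
    Jet k l (fun w => ∑ i ∈ s, f i w) (∑ i ∈ s, a i) (∑ i ∈ s, b i) (∑ i ∈ s, c i)
      (∑ i ∈ s, d i) := by
  classical
  induction s using Finset.induction_on with
  | empty => simpa using Jet.const 0
  | insert i s his ih =>
    simp only [Finset.sum_insert his]
    exact (hf i).add ih

lemma Jet.uniq {f : EuclideanSpace ℂ (Fin n) → ℂ} {a b c d a' b' c' d' : ℂ}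
    (hf : Jet k l f a b c d) (hg : Jet k l f a' b' c' d') :
    a = a' ∧ b = b' ∧ c = c' ∧ d = d' :=
  ⟨hf.v.symm.trans hg.v, hf.d1.symm.trans hg.d1, hf.d2.symm.trans hg.d2, hf.dd.symm.trans hg.dd⟩

lemma Sm.conj {f : EuclideanSpace ℂ (Fin n) → ℂ} (hf : Sm f) :
    Sm (fun w => (starRingEnd ℂ) (f w)) :=
  (Complex.conjCLE.contDiff.contDiffAt).comp (0 : EuclideanSpace ℂ (Fin n)) hf

lemma Jet.coord (i : Fin n) : Jet k l (fun z : EuclideanSpace ℂ (Fin n) => z i)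
    0 (if i = k then 1 else 0) 0 0 := by
  refine ⟨sm_coord i, rfl, wd_coord _ _ _, wdb_coord _ _ _, ?_⟩
  have : wdb l (fun z : EuclideanSpace ℂ (Fin n) => z i) = fun _ => 0 := by
    funext z; exact wdb_coord _ _ _
  rw [this, wd_const]

lemma Jet.coordbar (i : Fin n) :
    Jet k l (fun z : EuclideanSpace ℂ (Fin n) => (starRingEnd ℂ) (z i))
    0 0 (if i = l then 1 else 0) 0 := by
  have e : wdb l (fun z : EuclideanSpace ℂ (Fin n) => (starRingEnd ℂ) (z i))
      = fun _ => if i = l then 1 else 0 := by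
    funext z; rw [wdb_conj, wd_coord]; split_ifs <;> simp
  refine ⟨(sm_coord i).conj, by simp, ?_, by rw [e], ?_⟩
  · rw [wd_conj, wdb_coord]; simp
  · rw [e, wd_const]

lemma sm_det {m : ℕ} (A : Fin m → Fin m → EuclideanSpace ℂ (Fin n) → ℂ)
    (hA : ∀ i j, Sm (A i j)) : Sm (fun z => (Matrix.of fun i j => A i j z).det) := by
  simp only [Matrix.det_apply', Sm, Matrix.of_apply]
  refine ContDiffAt.sum fun σ _ => contDiffAt_const.mul ?_
  exact contDiffAt_prod fun i _ => hA _ _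

lemma sm_ginv (g : Fin n → Fin n → EuclideanSpace ℂ (Fin n) → ℂ)
    (hg : ∀ i j, Sm (g i j)) (h0 : (Matrix.of fun i j => g i j 0).det ≠ 0) (p q : Fin n) :
    Sm (fun z => ginv g z p q) := by
  have e : (fun z => ginv g z p q) = fun z => ((Matrix.of fun i j => g i j z).det)⁻¹
      * (Matrix.of fun i j => (if i = p then (fun _ => Pi.single q 1 j) else g i j) z).det := by
    funext z
    simp only [ginv, Matrix.transpose_apply, Matrix.inv_def, Matrix.smul_apply,
      Ring.inverse_eq_inv', smul_eq_mul, Matrix.adjugate_apply]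
    congr 2
    ext i j
    by_cases hi : i = p
    · subst hi; simp
    · simp [hi]
  rw [e]
  refine ContDiffAt.mul (ContDiffAt.inv (sm_det g hg) h0) (sm_det _ ?_)
  intro i j
  split_ifs
  · exact contDiffAt_const
  · exact hg i j

/-- Jet of an inverse matrix of a normalized metric. -/
lemma jet_ginv (g : Fin n → Fin n → EuclideanSpace ℂ (Fin n) → ℂ)
    (hg : ∀ i j, Sm (g i j)) (hg0 : ∀ i j : Fin n, g i j 0 = if i = j then 1 else 0)
    (hdg0 : ∀ i j k : Fin n, wd k (g i j) 0 = 0 ∧ wdb k (g i j) 0 = 0) (p q : Fin n) :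
    Jet k l (fun z => ginv g z p q) (if p = q then 1 else 0) 0 0 (- wd k (wdb l (g q p)) 0) := by
  have h1 : (Matrix.of fun i j => g i j 0) = 1 := by
    ext i j; simp [hg0, Matrix.one_apply]
  have hsm := sm_ginv g hg (by rw [h1]; simp)
  have hv : ∀ p q, ginv g 0 p q = if p = q then 1 else 0 := by
    intro p q; simp [ginv, h1, Matrix.one_apply, eq_comm]
  have hdet : ∀ᶠ z in nhds (0 : EuclideanSpace ℂ (Fin n)),
      (Matrix.of fun i j => g i j z).det ≠ 0 :=
    (sm_det g hg).continuousAt.eventually_ne (by rw [h1]; simp)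
  have e : (fun z => ∑ r, g q r z * ginv g z p r) =ᶠ[nhds 0] fun _ => if q = p then 1 else 0 := by
    filter_upwards [hdet] with z hz
    have := Matrix.mul_nonsing_inv (Matrix.of fun i j => g i j z) (isUnit_iff_ne_zero.mpr hz)
    have := congrFun (congrFun this q) p
    rw [Matrix.mul_apply, Matrix.one_apply] at this
    exact this
  have hs : Jet k l (fun z => ∑ r, g q r z * ginv g z p r) _ _ _ _ :=
    Jet.sum Finset.univ fun r => ((hg q r).jet (k := k) (l := l)).mul ((hsm p r).jet)
  obtain ⟨-, h2, h3, h4⟩ := hs.uniq ((Jet.const _).congr e)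
  simp [hg0, hdg0, hv, Finset.sum_add_distrib] at h2 h3 h4
  refine ⟨hsm p q, hv p q, h2, h3, ?_⟩
  linear_combination h4

end helpers

/-- In the normalized local setup at the origin,
`(∂_k ∂_l̄ K^{ij̄})(0) = −R_{jīkl̄}(0) − (δ^{ij} δ_{kl} + δ^i_k δ^j_l)`
for `1 ≤ i, j, k, l ≤ n`. -/
theorem ddbarKmat_at_origin
    (n : ℕ) (Ω : Set (EuclideanSpace ℂ (Fin n)))
    (hΩ : IsOpen Ω) (h0Ω : (0 : EuclideanSpace ℂ (Fin n)) ∈ Ω)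
    -- `g_{ij̄} = ∂_i∂_j̄ φ` is positive definite on the neighborhood `Ω` of `0`:
    (φ : EuclideanSpace ℂ (Fin n) → ℝ) (hφ : ContDiffOn ℝ (⊤ : ℕ∞) φ Ω)
    (g : Fin n → Fin n → EuclideanSpace ℂ (Fin n) → ℂ)
    (hgφ : ∀ i j : Fin n, ∀ z ∈ Ω, g i j z = wd i (wdb j (fun w => (φ w : ℂ))) z)
    (hposdef : ∀ z ∈ Ω, (Matrix.of fun i j => g i j z).PosDef)
    -- normalization of `g` at the origin:
    (hg0 : ∀ i j : Fin n, g i j 0 = if i = j then 1 else 0)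
    (hdg0 : ∀ i j k : Fin n, wd k (g i j) 0 = 0 ∧ wdb k (g i j) 0 = 0)
    -- `h` is a smooth positive function with `g = −∂∂̄ log h`, normalized at the origin:
    (h : EuclideanSpace ℂ (Fin n) → ℝ) (hsm : ContDiffOn ℝ (⊤ : ℕ∞) h Ω)
    (hpos : ∀ z ∈ Ω, 0 < h z)
    (hgh : ∀ i j : Fin n, ∀ z ∈ Ω,
      g i j z = -wd i (wdb j (fun w => (Real.log (h w) : ℂ))) z)
    (hh0 : h 0 = 1) (hdh0 : fderiv ℝ h 0 = 0)
    (hh2 : ∀ i j : Fin n, wd i (wd j (fun w => (h w : ℂ))) 0 = 0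
      ∧ wdb i (wdb j (fun w => (h w : ℂ))) 0 = 0)
    :
    ∀ i j k l : Fin n,
      wd k (wdb l (Kmat h g i.succ j.succ)) 0
        = -Riem g j i k l 0
          - ((if i = j then 1 else 0) * (if k = l then 1 else 0)
            + (if i = k then 1 else 0) * (if j = l then 1 else 0)) := by
  intro i j k l
  have hnh : Ω ∈ nhds (0 : EuclideanSpace ℂ (Fin n)) := hΩ.mem_nhds h0Ω
  have sφ : Sm (fun w => (φ w : ℂ)) :=
    (Complex.ofRealCLM.contDiff.contDiffAt).comp (0 : EuclideanSpace ℂ (Fin n)) (hφ.contDiffAt hnh)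
  have sh : Sm (fun w => (h w : ℂ)) :=
    (Complex.ofRealCLM.contDiff.contDiffAt).comp (0 : EuclideanSpace ℂ (Fin n)) (hsm.contDiffAt hnh)
  have sg : ∀ i j, Sm (g i j) := by
    intro i j
    refine ContDiffAt.congr_of_eventuallyEq ((sφ.wdb j).wd i) ?_
    filter_upwards [hnh] with z hz using hgφ i j z hz
  have hc0 : (h 0 : ℂ) ≠ 0 := by simp [hh0]
  have shi : Sm (fun w => (h w : ℂ)⁻¹) := ContDiffAt.inv sh hc0
  have fdR : ∀ (f : EuclideanSpace ℂ (Fin n) → ℝ) z, DifferentiableAt ℝ f z →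
      ∀ v, fderiv ℝ (fun w => (f w : ℂ)) z v = (fderiv ℝ f z v : ℂ) := by
    intro f z hf v
    have := (Complex.ofRealCLM.hasFDerivAt.comp z hf.hasFDerivAt).fderiv
    exact congrArg (fun L => L v) this
  have hdiff : ∀ z ∈ Ω, DifferentiableAt ℝ h z := fun z hz =>
    (hsm.contDiffAt (hΩ.mem_nhds hz)).differentiableAt (by simp)
  have hd1 : ∀ p, wd p (fun w => (h w : ℂ)) 0 = 0 := by
    intro p; simp [wd, fdR h 0 (hdiff 0 h0Ω), hdh0]
  have hd2 : ∀ p, wdb p (fun w => (h w : ℂ)) 0 = 0 := by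
    intro p; simp [wdb, fdR h 0 (hdiff 0 h0Ω), hdh0]
  have hlog : ∀ q, wdb q (fun w => (Real.log (h w) : ℂ)) =ᶠ[nhds 0]
      fun z => (h z : ℂ)⁻¹ * wdb q (fun w => (h w : ℂ)) z := by
    intro q
    filter_upwards [hnh] with z hz
    have hl := ((hdiff z hz).hasFDerivAt.log (hpos z hz).ne')
    simp only [wdb, fdR h z (hdiff z hz), fdR _ z hl.differentiableAt, hl.fderiv]
    simp
    ring
  have hD : ∀ p q, wd p (wdb q (fun w => (h w : ℂ))) 0 = - if p = q then 1 else 0 := by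
    intro p q
    have h1 := hgh p q 0 h0Ω
    rw [hg0, wd_congr (hlog q), wd_mul shi.da (sh.wdb q).da, hd2] at h1
    simp [hh0] at h1
    rw [h1]; ring
  have hconj : ∀ q, wdb q (fun w => (h w : ℂ))
      = fun z => (starRingEnd ℂ) (wd q (fun w => (h w : ℂ)) z) := by
    intro q; funext z
    rw [← wdb_conj]; simp
  have hD' : ∀ p q, wdb p (wd q (fun w => (h w : ℂ))) 0 = - if p = q then 1 else 0 := by
    intro p q
    have h1 := hD p q
    rw [hconj, wd_conj] at h1
    have h2 := congrArg (starRingEnd ℂ) h1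
    rw [Complex.conj_conj] at h2
    rw [h2]; split_ifs <;> simp
  have jh : Jet k l (fun w => (h w : ℂ)) 1 0 0 (- if k = l then 1 else 0) :=
    ⟨sh, by simp [hh0], hd1 k, hd2 l, hD k l⟩
  have jhi : Jet k l (fun w => (h w : ℂ)⁻¹) 1 0 0 (if k = l then 1 else 0) := by
    have e : (fun w => (h w : ℂ) * (h w : ℂ)⁻¹) =ᶠ[nhds 0] fun _ => 1 := by
      filter_upwards [hnh] with z hz
      exact mul_inv_cancel₀ (by exact_mod_cast (hpos z hz).ne')
    obtain ⟨h1, h2, h3, h4⟩ := (jh.mul (shi.jet)).uniq ((Jet.const 1).congr e)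
    refine ⟨shi, by simp [hh0], ?_, ?_, ?_⟩
    · linear_combination h2
    · linear_combination h3
    · simp only [hh0, Complex.ofReal_one, inv_one] at h4
      linear_combination h4
  have jp : ∀ p, Jet k l (wd p (fun w => (h w : ℂ))) 0 0 (- if l = p then 1 else 0)
      (wd k (wdb l (wd p (fun w => (h w : ℂ)))) 0) := fun p =>
    ⟨sh.wd p, hd1 p, (hh2 k p).1, hD' l p, rfl⟩
  have jq : ∀ q, Jet k l (wdb q (fun w => (h w : ℂ))) 0 (- if k = q then 1 else 0) 0
      (wd k (wdb l (wdb q (fun w => (h w : ℂ)))) 0) := fun q =>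
    ⟨sh.wdb q, hd2 q, hD k q, (hh2 l q).2, rfl⟩
  have jA : ∀ p, Jet k l (fun z => (if i = p then 1 else 0)
      - z i * (h z : ℂ)⁻¹ * wd p (fun w => (h w : ℂ)) z) (if i = p then 1 else 0) 0 0
      ((if i = k then 1 else 0) * (if l = p then 1 else 0)) := fun p =>
    ((Jet.const _).sub (((Jet.coord i).mul jhi).mul (jp p))).cast
      (by ring) (by ring) (by ring) (by ring)
  have jB : ∀ q, Jet k l (fun z => (if j = q then 1 else 0)
      - (starRingEnd ℂ) (z j) * (h z : ℂ)⁻¹ * wdb q (fun w => (h w : ℂ)) z)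
      (if j = q then 1 else 0) 0 0
      ((if j = l then 1 else 0) * (if k = q then 1 else 0)) := fun q =>
    ((Jet.const _).sub (((Jet.coordbar j).mul jhi).mul (jq q))).cast
      (by ring) (by ring) (by ring) (by ring)
  have hK : Kmat h g i.succ j.succ = fun z => (h z : ℂ)⁻¹ * z i * (starRingEnd ℂ) (z j)
      - (h z : ℂ)⁻¹ * ∑ p, ∑ q, ginv g z p q
        * ((if i = p then 1 else 0) - z i * (h z : ℂ)⁻¹ * wd p (fun w => (h w : ℂ)) z)
        * ((if j = q then 1 else 0)
          - (starRingEnd ℂ) (z j) * (h z : ℂ)⁻¹ * wdb q (fun w => (h w : ℂ)) z) := by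
    funext z
    simp only [Kmat, uu_succ, wd_coord, hconj, map_sub, map_mul, map_inv₀, Complex.conj_ofReal,
      apply_ite (starRingEnd ℂ), map_one, map_zero]
  have jK := ((jhi.mul (Jet.coord i)).mul (Jet.coordbar j)).sub (jhi.mul
    (Jet.sum Finset.univ fun p => Jet.sum Finset.univ fun q =>
      ((jet_ginv g sg hg0 hdg0 p q).mul (jA p)).mul (jB q)))
  have hR : Riem g j i k l 0 = - wd k (wdb l (g j i)) 0 := by
    simp [Riem, hdg0]
  rw [hK, jK.dd, hR]
  simp [Finset.sum_add_distrib, mul_add, Finset.sum_ite_eq]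
  clear * -
  generalize wd k (wdb l (g j i)) 0 = X
  have hc : (l = j) = (j = l) := propext eq_comm
  simp only [hc]
  split_ifs <;> ring
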